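/- arXiv:2003.13019 — 2 statements merged into one kernel-verified Lean document; each statement's English description precedes it below -/
import Mathlib

section
/- Let p be an odd prime and d = (p^k + 1)/2. The power function F(x) = x^d on GF(p^n) is P_cN for c = -1 (i.e., for every b ∈ GF(p^n) the equation (x+1)^d + x^d = b has exactly one solution x ∈ GF(p^n)) if and only if k/gcd(k,n) is even. -/
def cDelta {F : Type*} [Field F] [Fintype F] [DecidableEq F]
    (f : F → F) (c a b : F) : ℕ :=
  (Finset.univ.filter (fun x : F => f (x + a) - c * f x = b)).card

def cUnif {F : Type*} [Field F] [Fintype F] [DecidableEq F]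
    (f : F → F) (c : F) : ℕ :=
  Finset.univ.sup fun a : F => Finset.univ.sup fun b : F => cDelta f c a b

theorem nt1 (p n k : ℕ) (hodd : Odd p) (hn : 0 < n) (hk : 0 < k)
    (h : Even (k / Nat.gcd k n)) (e : ℕ) (he : e.Prime) (h1 : e ∣ (p^k+1)/2)
    (h2 : e ∣ (p^n)^2 - 1) : False := by
  obtain ⟨g, a, b, hg, hab, rfl, rfl⟩ := Nat.exists_coprime' (Nat.gcd_pos_of_pos_left n hk)
  have hgcd : Nat.gcd (a*g) (b*g) = g := by rw [Nat.gcd_mul_right, hab.gcd_eq_one, one_mul]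
  rw [hgcd, Nat.mul_div_cancel _ hg] at h
  obtain ⟨c, rfl⟩ := h
  have hb : Odd b := by
    rw [← Nat.not_even_iff_odd]
    rintro hb
    have : 2 ∣ Nat.gcd (c+c) b := Nat.dvd_gcd (by omega) hb.two_dvd
    rw [hab.gcd_eq_one] at this
    omega
  have hk4 : p ^ ((c+c)*g) % 4 = 1 := by
    have : p ^ ((c+c)*g) = (p^(c*g))^2 := by ring
    rw [this]
    obtain ⟨m, hm⟩ := hodd.pow (n := c*g)
    rw [hm]; ring_nf; omega
  have h3 : e ∣ p ^ ((c+c)*g) + 1 := h1.trans (Nat.div_dvd_of_dvd (by omega))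
  have e2 : e ≠ 2 := by
    rintro rfl
    omega
  have := Fact.mk he
  have h4 : (p:ZMod e) ^ ((c+c)*g) = -1 := by
    have := (ZMod.natCast_eq_zero_iff _ _).2 h3
    push_cast at this
    exact eq_neg_of_add_eq_zero_left this
  have h5 : ((p:ZMod e) ^ (b*g))^2 = 1 := by
    have := (ZMod.natCast_eq_zero_iff _ _).2 h2
    rw [Nat.cast_sub (Nat.one_le_pow _ _ (by have := hodd.pos; positivity))] at this
    push_cast at this
    exact sub_eq_zero.1 this
  have h6 : (-1 : ZMod e) = 1 := by
    calc (-1 : ZMod e) = (-1)^b := hb.neg_one_pow.symm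
      _ = (((p:ZMod e) ^ (b*g))^2)^c := by rw [← h4]; ring
      _ = 1 := by rw [h5, one_pow]
  have : Fact (2 < e) := ⟨by have := he.two_le; omega⟩
  exact ZMod.neg_one_ne_one h6

theorem nt2 (p n k : ℕ) (hp : p.Prime) (hodd : Odd p) (hk : 0 < k)
    (h : ¬ Even (k / Nat.gcd k n)) : ∃ e : ℕ, e.Prime ∧ e ∣ (p^k+1)/2 ∧
    (e ∣ p^n - 1 ∨ e ∣ p^n + 1) := by
  obtain ⟨g, a, b, hg, hab, rfl, rfl⟩ := Nat.exists_coprime' (Nat.gcd_pos_of_pos_left n hk)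
  have hgcd : Nat.gcd (a*g) (b*g) = g := by rw [Nat.gcd_mul_right, hab.gcd_eq_one, one_mul]
  rw [hgcd, Nat.mul_div_cancel _ hg, Nat.not_even_iff_odd] at h
  have hP : 2 < p ^ g := by
    have : p ≤ p ^ g := Nat.le_self_pow hg.ne' p
    have := hp.two_le
    obtain ⟨m, hm⟩ := hodd
    omega
  have hPo := hodd.pow (n := g)
  rw [mul_comm a g, mul_comm b g, pow_mul, pow_mul]
  generalize p ^ g = P at *
  obtain ⟨m, rfl⟩ := hPo
  have hm : m + 1 ≠ 1 := by omega
  have hd : (2*m+1) + 1 ∣ (2*m+1)^a + 1 := by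
    simpa using h.nat_add_dvd_pow_add_pow (2*m+1) 1
  have hd' : m + 1 ∣ ((2*m+1)^a + 1)/2 := by
    obtain ⟨t, ht⟩ := hd
    rw [ht]
    refine ⟨t, ?_⟩
    rw [show (2*m+1+1)*t = 2*((m+1)*t) by ring]
    simp
  refine ⟨(m+1).minFac, Nat.minFac_prime hm, (Nat.minFac_dvd _).trans hd', ?_⟩
  have h0 : (m+1).minFac ∣ 2*m+1+1 := (Nat.minFac_dvd _).trans ⟨2, by ring⟩
  rcases Nat.even_or_odd b with ⟨c, rfl⟩ | hb
  · left
    refine h0.trans ?_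
    have h1 : (2*m+1)^2 - 1 ∣ ((2*m+1)^2)^c - 1 := by
      simpa using Nat.sub_dvd_pow_sub_pow ((2*m+1)^2) 1 c
    rw [← two_mul, pow_mul]
    refine Dvd.dvd.trans ?_ h1
    have := Nat.sq_sub_sq (2*m+1) 1
    rw [one_pow] at this
    rw [this]
    exact dvd_mul_right _ _
  · right
    exact h0.trans (by simpa using hb.nat_add_dvd_pow_add_pow (2*m+1) 1)

theorem key {K : Type*} [Field K] (p k : ℕ) [Fact p.Prime] [CharP K p] (hodd : Odd p) (z w x : K)
    (hzw : z * w = 1) (hx : 4 * x = (z - w)^2) :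
    2 * ((x+1)^((p^k+1)/2) + x^((p^k+1)/2)) = (z^2)^((p^k+1)/2) + (w^2)^((p^k+1)/2) := by
  have h2p : (2:K)^(p^k) = 2 := by
    have : ((2:ZMod p)^(p^k)) = 2 := ZMod.pow_card_pow 2
    have := congrArg (ZMod.castHom (dvd_refl p) K) this
    rwa [map_pow, map_ofNat] at this
  have h2 : (2:K) ≠ 0 := by
    intro h
    have : ((2:ℕ):K) = 0 := by exact_mod_cast h
    rw [CharP.cast_eq_zero_iff K p] at this
    have := (Nat.prime_dvd_prime_iff_eq Fact.out Nat.prime_two).1 this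
    subst this
    exact absurd hodd (by decide)
  have hd : 2 * ((p^k+1)/2) = p^k+1 := by
    obtain ⟨m, hm⟩ := hodd.pow (n := k)
    omega
  have e1 : x = ((z-w)/2)^2 := by field_simp; linear_combination hx
  have e2 : x + 1 = ((z+w)/2)^2 := by field_simp; linear_combination hx - 4*hzw
  rw [e2, e1, ← pow_mul, ← pow_mul, ← pow_mul, ← pow_mul, hd, pow_succ, pow_succ, pow_succ, pow_succ,
    div_pow, div_pow, h2p, sub_pow_char_pow, add_pow_char_pow]
  field_simp
  ring

theorem fixed_mem {F K : Type*} [Field F] [Fintype F] [Field K] [Algebra F K] (x : K)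
    (hx : x ^ Fintype.card F = x) : ∃ y : F, algebraMap F K y = x := by
  classical
  have hs := FiniteField.X_pow_card_sub_X_natDegree_eq K (p := Fintype.card F) Fintype.one_lt_card
  have hne := FiniteField.X_pow_card_sub_X_ne_zero K (p := Fintype.card F) Fintype.one_lt_card
  set P : Polynomial K := Polynomial.X ^ Fintype.card F - Polynomial.X with hP
  have hsub : Finset.univ.image (algebraMap F K) ⊆ P.roots.toFinset := by
    intro y hy
    obtain ⟨a, -, rfl⟩ := Finset.mem_image.1 hy
    rw [Multiset.mem_toFinset, Polynomial.mem_roots hne]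
    simp [hP, ← map_pow, FiniteField.pow_card]
  have heq := Finset.eq_of_subset_of_card_le hsub (by
    rw [Finset.card_image_of_injective _ (algebraMap F K).injective, Finset.card_univ]
    exact (Multiset.toFinset_card_le _).trans ((Polynomial.card_roots' P).trans hs.le))
  have : x ∈ P.roots.toFinset := by
    rw [Multiset.mem_toFinset, Polynomial.mem_roots hne]
    simp [hP, hx]
  rw [← heq] at this
  obtain ⟨a, -, rfl⟩ := Finset.mem_image.1 this
  exact ⟨a, rfl⟩

theorem cUnif_iff {F : Type*} [Field F] [Fintype F] [DecidableEq F] (d : ℕ) :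
    cUnif (fun x : F => x ^ d) (-1 : F) = 1 ↔
    ∀ a : F, Function.Injective (fun x : F => (x + a)^d + x^d) := by
  have h1 : ∀ a b : F, cDelta (fun x : F => x ^ d) (-1 : F) a b =
      (Finset.univ.filter (fun x : F => (x+a)^d + x^d = b)).card := by
    intro a b
    simp [cDelta]
  constructor
  · intro h a x y hxy
    have h2 : cDelta (fun x : F => x ^ d) (-1 : F) a ((y+a)^d + y^d) ≤ 1 := by
      rw [← h]
      exact (Finset.le_sup (f := fun b => cDelta (fun x : F => x ^ d) (-1 : F) a b)
        (Finset.mem_univ _)).trans (Finset.le_sup (f := fun a => Finset.univ.sup fun b =>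
          cDelta (fun x : F => x ^ d) (-1 : F) a b) (Finset.mem_univ a))
    rw [h1] at h2
    exact Finset.card_le_one.1 h2 x (by simpa using hxy) y (by simp)
  · intro h
    apply le_antisymm
    · refine Finset.sup_le fun a _ => Finset.sup_le fun b _ => ?_
      rw [h1]
      refine Finset.card_le_one.2 fun x hx y hy => h a ?_
      simp only [Finset.mem_filter, Finset.mem_univ, true_and] at hx hy
      exact hx.trans hy.symm
    · have h2 : 1 ≤ cDelta (fun x : F => x ^ d) (-1 : F) 0 ((0+0)^d + 0^d) := by
        rw [h1, Nat.one_le_iff_ne_zero]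
        refine Finset.card_ne_zero_of_mem (a := 0) ?_
        simp
      exact h2.trans ((Finset.le_sup (f := fun b => cDelta (fun x : F => x ^ d) (-1 : F) 0 b)
        (Finset.mem_univ _)).trans (Finset.le_sup (f := fun a => Finset.univ.sup fun b =>
          cDelta (fun x : F => x ^ d) (-1 : F) a b) (Finset.mem_univ 0)))

theorem one_of_coprime {M : Type*} [Monoid M] (y : M) (m n : ℕ) (h : Nat.Coprime m n)
    (h1 : y ^ m = 1) (h2 : y ^ n = 1) : y = 1 := by
  have := Nat.dvd_gcd (orderOf_dvd_of_pow_eq_one h1) (orderOf_dvd_of_pow_eq_one h2)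
  rw [h.gcd_eq_one, Nat.dvd_one] at this
  exact orderOf_eq_one_iff.1 this

theorem two_ne {K : Type*} [Field K] (p : ℕ) (hp : p.Prime) [CharP K p] (hodd : Odd p) :
    (2:K) ≠ 0 := by
  intro h
  have : ((2:ℕ):K) = 0 := by exact_mod_cast h
  rw [CharP.cast_eq_zero_iff K p] at this
  have := (Nat.prime_dvd_prime_iff_eq hp Nat.prime_two).1 this
  subst this
  exact absurd hodd (by decide)

/-- pairs (y, 1/y) attached to x -/
theorem exists_pair {F K : Type*} [Field F] [Fintype F] [Field K] [Algebra F K] [IsAlgClosed K]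
    (p n k : ℕ) [Fact p.Prime] [CharP K p] (hodd : Odd p)
    (hcard : Fintype.card F = p ^ n) (x : F) :
    ∃ y w : K, y * w = 1 ∧ y + w = 4 * algebraMap F K x + 2 ∧ y ^ ((p^n)^2) = y ∧
      2 * algebraMap F K ((x+1)^((p^k+1)/2) + x^((p^k+1)/2)) =
        y^((p^k+1)/2) + w^((p^k+1)/2) := by
  obtain ⟨u, hu⟩ := IsAlgClosed.exists_pow_nat_eq (algebraMap F K x) (n := 2) (by norm_num)
  obtain ⟨v, hv⟩ := IsAlgClosed.exists_pow_nat_eq (algebraMap F K x + 1) (n := 2) (by norm_num)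
  have h1 : (v + u) * (v - u) = 1 := by linear_combination hv - hu
  have hyw : (v+u)^2 * (v-u)^2 = 1 := by rw [← mul_pow, h1, one_pow]
  have hs : (v+u)^2 + (v-u)^2 = 4 * algebraMap F K x + 2 := by linear_combination 2*hu + 2*hv
  refine ⟨(v+u)^2, (v-u)^2, hyw, hs, ?_, ?_⟩
  · generalize (v+u)^2 = y at *
    generalize (v-u)^2 = w at *
    obtain ⟨s, hs'⟩ : ∃ s : F, algebraMap F K s = y + w := ⟨4*x+2, by rw [hs, map_add, map_mul, map_ofNat, map_ofNat]⟩
    have h3 : y ^ (p^n) + w ^ (p^n) = y + w := by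
      rw [← add_pow_char_pow, ← hs', ← map_pow, ← hcard, FiniteField.pow_card]
    have h4 : y ^ (p^n) * w ^ (p^n) = 1 := by rw [← mul_pow, hyw, one_pow]
    have h5 : (y ^ (p^n) - y) * (y ^ (p^n) - w) = 0 := by
      linear_combination y ^ (p^n) * h3 - h4 + hyw
    rw [pow_two (p^n), pow_mul]
    rcases mul_eq_zero.1 h5 with h | h
    · rw [sub_eq_zero.1 h, sub_eq_zero.1 h]
    · have h6 : y ^ (p^n) = w := sub_eq_zero.1 h
      rw [h6]
      rw [h6] at h3
      linear_combination h3
  · have := key p k hodd (v+u) (v-u) (algebraMap F K x) h1 (by linear_combination -4*hu)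
    simpa using this

theorem inj_one {F : Type*} [Field F] [Fintype F]
    (p n k : ℕ) (hp : p.Prime) (hodd : Odd p)
    (hcard : Fintype.card F = p ^ n) (hc : Nat.Coprime ((p^k+1)/2) ((p^n)^2-1)) :
    Function.Injective (fun x : F => (x + 1)^((p^k+1)/2) + x^((p^k+1)/2)) := by
  have := Fact.mk hp
  have : CharP F p := charP_of_card_eq_prime_pow hcard
  have : CharP (AlgebraicClosure F) p := charP_of_injective_algebraMap
    (algebraMap F (AlgebraicClosure F)).injective p
  have h2 := two_ne (K := AlgebraicClosure F) p hp hodd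
  intro x1 x2 hx
  obtain ⟨y1, w1, a1, b1, c1, d1⟩ :=
    exists_pair (K := AlgebraicClosure F) p n k hodd hcard x1
  obtain ⟨y2, w2, a2, b2, c2, d2⟩ :=
    exists_pair (K := AlgebraicClosure F) p n k hodd hcard x2
  simp only at hx
  rw [hx, d2] at d1
  set d := (p^k+1)/2 with hd
  have pw : ∀ y w : AlgebraicClosure F, y * w = 1 → y ^ ((p^n)^2) = y →
      y ^ ((p^n)^2-1) = 1 := by
    intro y w h h'
    have hy : y ≠ 0 := left_ne_zero_of_mul_eq_one h
    apply mul_right_cancel₀ hy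
    rw [pow_sub_one_mul (by have := hp.pos; positivity), h', one_mul]
  have e1 := pw _ _ a1 c1
  have e2 := pw _ _ a2 c2
  have f1 : y1^d * w1^d = 1 := by rw [← mul_pow, a1, one_pow]
  have f2 : y2^d * w2^d = 1 := by rw [← mul_pow, a2, one_pow]
  have e2' : w2 ^ ((p^n)^2-1) = 1 := by
    have : y2 ^ ((p^n)^2-1) * w2 ^ ((p^n)^2-1) = 1 := by rw [← mul_pow, a2, one_pow]
    rwa [e2, one_mul] at this
  have h4 : (y1^d - y2^d) * (y1^d - w2^d) = 0 := by
    linear_combination -y1^d * d1 - f1 + f2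
  have hfin : y1 + w1 = y2 + w2 := by
    rcases mul_eq_zero.1 h4 with h | h
    · have : y1 * w2 = 1 := one_of_coprime _ _ _ hc
        (by rw [mul_pow, sub_eq_zero.1 h, f2]) (by rw [mul_pow, e1, e2', one_mul])
      have h5 : y1 = y2 := by linear_combination y2 * this - y1 * a2
      have h6 : w1 = w2 := by linear_combination w2 * a1 - w1 * this
      rw [h5, h6]
    · have : y1 * y2 = 1 := one_of_coprime _ _ _ hc
        (by rw [mul_pow, sub_eq_zero.1 h, mul_comm, f2]) (by rw [mul_pow, e1, e2, one_mul])
      have h5 : y1 = w2 := by linear_combination w2 * this - y1 * a2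
      have h6 : w1 = y2 := by linear_combination y2 * a1 - w1 * this
      rw [h5, h6, add_comm]
  rw [b1, b2] at hfin
  have h7 : (2:AlgebraicClosure F) * 2 * (algebraMap F _ x1 - algebraMap F _ x2) = 0 := by
    linear_combination hfin
  have h8 := (mul_eq_zero.1 h7).resolve_left (mul_ne_zero h2 h2)
  exact (algebraMap F (AlgebraicClosure F)).injective (sub_eq_zero.1 h8)

theorem inj_all {F : Type*} [Field F] [Fintype F]
    (p n k : ℕ) (hp : p.Prime) (hodd : Odd p)
    (hcard : Fintype.card F = p ^ n) (hc : Nat.Coprime ((p^k+1)/2) ((p^n)^2-1)) (a : F) :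
    Function.Injective (fun x : F => (x + a)^((p^k+1)/2) + x^((p^k+1)/2)) := by
  have hinj := inj_one p n k hp hodd hcard hc
  have : CharP F p := @charP_of_card_eq_prime_pow F _ _ _ p n (Fact.mk hp) hcard
  have h2 := two_ne (K := F) p hp hodd
  have hd : (p^k+1)/2 ≠ 0 := by
    have : 0 < p ^ k := Nat.pow_pos hp.pos
    omega
  set d := (p^k+1)/2
  intro x y hxy
  simp only at hxy
  by_cases ha : a = 0
  · subst ha
    have hxy' : x^d = y^d := by
      apply mul_left_cancel₀ h2
      simp only [add_zero] at hxy
      linear_combination hxy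
    by_cases hy : y = 0
    · subst hy
      rw [zero_pow hd] at hxy'
      exact pow_eq_zero_iff hd |>.1 hxy'
    · have hx : x ≠ 0 := by
        rintro rfl
        rw [zero_pow hd] at hxy'
        exact hy (pow_eq_zero_iff hd |>.1 hxy'.symm)
      have : x / y = 1 := by
        refine one_of_coprime _ d (p^n-1) (hc.coprime_dvd_right ?_) ?_ ?_
        · have := Nat.sq_sub_sq (p^n) 1
          rw [one_pow] at this
          rw [this]
          exact dvd_mul_left _ _
        · rw [div_pow, hxy', div_self (pow_ne_zero _ hy)]
        · rw [← hcard]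
          exact FiniteField.pow_card_sub_one_eq_one _ (div_ne_zero hx hy)
      exact (div_eq_one_iff_eq hy).1 this
  · have h3 : ∀ x : F, (x+a)^d + x^d = a^d * ((x/a+1)^d + (x/a)^d) := by
      intro x
      rw [mul_add, ← mul_pow, ← mul_pow]
      field_simp
    rw [h3, h3] at hxy
    have := hinj (mul_left_cancel₀ (pow_ne_zero d ha) hxy)
    exact (div_left_inj' ha).1 this

theorem not_inj {F : Type*} [Field F] [Fintype F]
    (p n k : ℕ) (hp : p.Prime) (hodd : Odd p) (hn : 0 < n)
    (hcard : Fintype.card F = p ^ n) (e : ℕ) (he : e.Prime) (h1 : e ∣ (p^k+1)/2)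
    (h2 : e ∣ p^n - 1 ∨ e ∣ p^n + 1)
    (hinj : ∀ a : F, Function.Injective (fun x : F => (x + a)^((p^k+1)/2) + x^((p^k+1)/2))) :
    False := by
  classical
  have := Fact.mk hp
  have := Fact.mk he
  rcases h2 with h2 | h2
  · have hu : e ∣ Fintype.card Fˣ := by rwa [Fintype.card_units, hcard]
    obtain ⟨u, hu⟩ := exists_prime_orderOf_dvd_card e hu
    have hud : u ^ ((p^k+1)/2) = 1 := orderOf_dvd_iff_pow_eq_one.1 (hu ▸ h1)
    have hud' : (u:F) ^ ((p^k+1)/2) = 1 := by rw [← Units.val_pow_eq_pow_val, hud, Units.val_one]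
    have : (u:F) = 1 := hinj 0 (by simp [hud'])
    have : u = 1 := Units.ext this
    rw [this, orderOf_one] at hu
    exact he.one_lt.ne hu
  · have : CharP F p := charP_of_card_eq_prime_pow hcard
    have : CharP (AlgebraicClosure F) p := charP_of_injective_algebraMap
      (algebraMap F (AlgebraicClosure F)).injective p
    have t2 := two_ne (K := AlgebraicClosure F) p hp hodd
    have : NeZero (e : AlgebraicClosure F) := ⟨by
      intro h
      rw [CharP.cast_eq_zero_iff _ p, Nat.prime_dvd_prime_iff_eq hp he] at h
      subst h
      have : p ∣ p ^ n := dvd_pow_self _ hn.ne'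
      exact he.one_lt.ne' (Nat.dvd_one.1 ((Nat.dvd_add_right this).1 h2))⟩
    obtain ⟨y, hy⟩ := HasEnoughRootsOfUnity.exists_primitiveRoot (AlgebraicClosure F) e
    obtain ⟨z, hz⟩ := IsAlgClosed.exists_pow_nat_eq y (n := 2) (by norm_num)
    have hy0 : y ≠ 0 := hy.ne_zero he.ne_zero
    have hz0 : z ≠ 0 := by
      rintro rfl
      apply hy0; rw [← hz]; simp
    have hyq : y ^ (p^n) = y⁻¹ := by
      apply eq_inv_of_mul_eq_one_left
      rw [← pow_succ]
      exact (hy.pow_eq_one_iff_dvd _).2 h2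
    obtain ⟨s, hs⟩ := fixed_mem (F := F) (y + y⁻¹) (by
      rw [hcard, add_pow_char_pow, inv_pow, hyq, inv_inv, add_comm])
    have t2F := two_ne (K := F) p hp hodd
    have hx4 : 4 * algebraMap F (AlgebraicClosure F) ((s-2)/(2*2)) = (z - z⁻¹)^2 := by
      rw [map_div₀, map_sub, map_mul, hs, ← hz]
      simp only [map_ofNat]
      field_simp
      ring
    have hk := key p k hodd z z⁻¹ _ (mul_inv_cancel₀ hz0) hx4
    have hyd : y ^ ((p^k+1)/2) = 1 := (hy.pow_eq_one_iff_dvd _).2 h1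
    rw [inv_pow, hz, inv_pow, hyd, inv_one] at hk
    have hd : (p^k+1)/2 ≠ 0 := by
      have : 0 < p ^ k := Nat.pow_pos hp.pos
      omega
    have h0 : (s-2)/(2*2) = 0 := by
      apply hinj 1
      apply (algebraMap F (AlgebraicClosure F)).injective
      apply mul_left_cancel₀ t2
      simp only [map_add, map_pow, map_one, map_zero, zero_add, one_pow, zero_pow hd, add_zero]
      rw [hk]; norm_num
    rw [h0, map_zero, mul_zero] at hx4
    have h3 : z - z⁻¹ = 0 := by simpa using hx4.symm
    have h4 : y = 1 := by
      rw [← hz, pow_two]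
      nth_rw 2 [sub_eq_zero.1 h3]
      exact mul_inv_cancel₀ hz0
    exact hy.ne_one he.one_lt h4

theorem stmt5 {F : Type*} [Field F] [Fintype F] [DecidableEq F]
    (p n k : ℕ) (hp : p.Prime) (hodd : Odd p) (hn : 0 < n) (hk : 0 < k)
    (hcard : Fintype.card F = p ^ n) :
    cUnif (fun x : F => x ^ ((p ^ k + 1) / 2)) (-1 : F) = 1 ↔
      Even (k / Nat.gcd k n) := by
  rw [cUnif_iff]
  constructor
  · intro h
    by_contra hne
    obtain ⟨e, he, h1, h2⟩ := nt2 p n k hp hodd hk hne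
    exact not_inj p n k hp hodd hn hcard e he h1 h2 h
  · intro h a
    refine inj_all p n k hp hodd hcard ?_ a
    by_contra hc
    obtain ⟨e, he, h1, h2⟩ := Nat.Prime.not_coprime_iff_dvd.1 hc
    exact nt1 p n k hodd hn hk h e he h1 h2
end

section
/- Let p be an odd prime, n an odd positive integer, and d = (p^n + 1)/(p + 1). Then the map x ↦ (x+1)^d + x^d is a bijection of GF(p^n); equivalently, the power function x^d is P_cN over GF(p^n) for c = -1. -/
theorem aux_inv {K : Type*} [Field K] {a b : K} (ha : a ≠ 0) (hb : b ≠ 0)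
    (h : a + a⁻¹ = b + b⁻¹) : a = b ∨ a * b = 1 := by
  have h1 : (a - b) * (a * b - 1) = 0 := by
    field_simp at h
    linear_combination h
  rcases mul_eq_zero.1 h1 with h | h
  · exact Or.inl (sub_eq_zero.1 h)
  · exact Or.inr (sub_eq_zero.1 h)

theorem aux_pow {K : Type*} [Field K] {a b : K} {E N : ℕ} (hb : b ≠ 0)
    (hc : Nat.Coprime E N) (ha1 : a ^ N = 1) (hb1 : b ^ N = 1) (h : a ^ E = b ^ E) : a = b := by
  have h1 : (a / b) ^ E = 1 := by rw [div_pow, h, div_self (pow_ne_zero _ hb)]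
  have h2 : (a / b) ^ N = 1 := by rw [div_pow, ha1, hb1, div_one]
  have h3 : orderOf (a / b) ∣ 1 := by
    rw [← hc.gcd_eq_one]
    exact Nat.dvd_gcd (orderOf_dvd_of_pow_eq_one h1) (orderOf_dvd_of_pow_eq_one h2)
  have h4 := pow_eq_one_iff_modEq (x := a / b) (n := 1)
  have h5 : a / b = 1 := by
    rw [← pow_one (a / b)]
    exact orderOf_dvd_iff_pow_eq_one.1 h3
  exact (div_eq_one_iff_eq hb).1 h5

theorem aux_param {K : Type*} [Field K] [IsAlgClosed K] (h2 : (2 : K) ≠ 0) (w : K) :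
    ∃ s : K, s ≠ 0 ∧ w = ((s + s⁻¹) / 2) ^ 2 ∧ w - 1 = ((s - s⁻¹) / 2) ^ 2 := by
  obtain ⟨r, hr⟩ := IsAlgClosed.exists_pow_nat_eq w (n := 2) (by norm_num)
  obtain ⟨m, hm⟩ := IsAlgClosed.exists_pow_nat_eq (r ^ 2 - 1) (n := 2) (by norm_num)
  have hs : (r + m) * (r - m) = 1 := by linear_combination -hm
  have hs0 : r + m ≠ 0 := left_ne_zero_of_mul_eq_one hs
  have hi : (r + m)⁻¹ = r - m := inv_eq_of_mul_eq_one_right hs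
  refine ⟨r + m, hs0, ?_, ?_⟩
  · rw [hi, ← hr]; field_simp; ring
  · rw [hi, ← hr]; field_simp; linear_combination -4 * hm

/-- value in terms of the parameter -/
theorem aux_val {K : Type*} [Field K] (p k E : ℕ) [Fact p.Prime] [CharP K p]
    (h2 : (2 : K) ≠ 0) (hE : 2 * E = p ^ k + 1) (w s : K) (hs : s ≠ 0)
    (h : w = ((s + s⁻¹) / 2) ^ 2) (h' : w - 1 = ((s - s⁻¹) / 2) ^ 2) :
    w ^ E + (w - 1) ^ E = ((s ^ 2) ^ E + ((s ^ 2) ^ E)⁻¹) / 2 := by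
  have h2p : (2 : K) ^ p ^ k = 2 := by
    have := add_pow_char_pow (R := K) (p := p) (n := k) 1 1
    rw [one_pow] at this
    norm_num at this
    exact this
  rw [h', h, ← pow_mul, ← pow_mul, ← pow_mul, hE, pow_succ, pow_succ, pow_succ, div_pow, div_pow,
    add_pow_char_pow, sub_pow_char_pow, h2p, inv_pow]
  have : s ^ p ^ k ≠ 0 := pow_ne_zero _ hs
  field_simp
  ring

theorem aux_inj' {F K : Type*} [Field F] [Fintype F] [Field K] [IsAlgClosed K] (φ : F →+* K) (p k E q : ℕ) [Fact p.Prime] [CharP F p]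
    (h2 : (2 : F) ≠ 0) (hE : 2 * E = p ^ k + 1) (hq : Fintype.card F = q) (j : ℕ) (hj : q = p ^ j)
    (hc : Nat.Coprime E ((q - 1) * (q + 1))) (w₁ w₂ : F)
    (h : w₁ ^ E + (w₁ - 1) ^ E = w₂ ^ E + (w₂ - 1) ^ E) : w₁ = w₂ := by
  have hφ : Function.Injective φ := φ.injective
  have : CharP K p := charP_of_injective_ringHom hφ p
  have h2K : (2 : K) ≠ 0 := by
    have := (map_ne_zero φ).2 h2
    rwa [map_ofNat] at this
  obtain ⟨s, hs, hs1, hs2⟩ := aux_param h2K (φ w₁)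
  obtain ⟨r, hr, hr1, hr2⟩ := aux_param h2K (φ w₂)
  have v1 := aux_val p k E h2K hE _ s hs hs1 hs2
  have v2 := aux_val p k E h2K hE _ r hr hr1 hr2
  have hK : (φ w₁) ^ E + (φ w₁ - 1) ^ E = (φ w₂) ^ E + (φ w₂ - 1) ^ E := by
    have := congrArg φ h
    simpa using this
  have hN : ∀ (w : F) (s : K), s ≠ 0 → φ w = ((s + s⁻¹) / 2) ^ 2 →
      (s ^ 2) ^ ((q - 1) * (q + 1)) = 1 := by
    intro w s hs hw
    have e1 : s ^ 2 + (s ^ 2)⁻¹ = φ (4 * w - 2) := by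
      have : φ (4 * w - 2) = 4 * φ w - 2 := by rw [map_sub, map_mul, map_ofNat, map_ofNat]
      rw [this, hw]; field_simp; ring
    have e2 : (s ^ 2) ^ q + ((s ^ 2) ^ q)⁻¹ = s ^ 2 + (s ^ 2)⁻¹ := by
      have : (s ^ 2 + (s ^ 2)⁻¹) ^ q = (φ (4 * w - 2)) ^ q := by rw [e1]
      rw [← map_pow, ← hq, FiniteField.pow_card, ← e1, hq, hj, add_pow_char_pow, ← hj, inv_pow] at this
      exact this
    have hs2 : s ^ 2 ≠ 0 := pow_ne_zero _ hs
    have hq1 : 1 ≤ q := by rw [← hq]; exact Fintype.card_pos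
    rcases aux_inv (pow_ne_zero _ hs2) hs2 e2 with e | e
    · rw [pow_mul]
      have : (s ^ 2) ^ (q - 1) = 1 := by
        have : (s ^ 2) ^ (q - 1) * s ^ 2 = 1 * s ^ 2 := by
          rw [← pow_succ, Nat.sub_add_cancel hq1, e, one_mul]
        exact mul_right_cancel₀ hs2 this
      rw [this, one_pow]
    · rw [mul_comm, pow_mul, pow_succ, e, one_pow]
  have hsN := hN _ s hs hs1
  have hrN := hN _ r hr hr1
  have hs0 : s ^ 2 ≠ 0 := pow_ne_zero _ hs
  have hr0 : r ^ 2 ≠ 0 := pow_ne_zero _ hr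
  have hv : (s ^ 2) ^ E + ((s ^ 2) ^ E)⁻¹ = (r ^ 2) ^ E + ((r ^ 2) ^ E)⁻¹ := by
    rw [v1, v2] at hK
    exact (div_left_inj' h2K).1 hK
  have key : s ^ 2 = r ^ 2 ∨ s ^ 2 = (r ^ 2)⁻¹ := by
    rcases aux_inv (pow_ne_zero _ hs0) (pow_ne_zero _ hr0) hv with e | e
    · exact Or.inl (aux_pow hr0 hc hsN hrN e)
    · refine Or.inr (aux_pow (inv_ne_zero hr0) hc hsN ?_ ?_)
      · rw [inv_pow, hrN, inv_one]
      · rw [inv_pow]; exact eq_inv_of_mul_eq_one_left e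
  apply hφ
  have f1 : φ w₁ = (s ^ 2 + (s ^ 2)⁻¹ + 2) / 4 := by
    rw [hs1]; have : (4 : K) = 2 * 2 := by norm_num
    rw [this]; field_simp; ring
  have f2 : φ w₂ = (r ^ 2 + (r ^ 2)⁻¹ + 2) / 4 := by
    rw [hr1]; have : (4 : K) = 2 * 2 := by norm_num
    rw [this]; field_simp; ring
  rw [f1, f2]
  rcases key with e | e
  · rw [e]
  · rw [e, inv_inv, add_comm (r ^ 2)⁻¹]

theorem aux_d (p : ℕ) (hodd : Odd p) (k : ℕ) :
    ∃ d, Odd d ∧ p ^ (2 * k + 1) + 1 = (p + 1) * d := by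
  induction k with
  | zero => exact ⟨1, by simp, by simp⟩
  | succ k ih =>
    obtain ⟨d, ⟨m, hm⟩, h⟩ := ih
    obtain ⟨r, hr⟩ := hodd
    refine ⟨2 * (p * p * m + 2 * r * r + r) + 1, ⟨_, rfl⟩, ?_⟩
    have : p ^ (2 * (k + 1) + 1) = p ^ (2 * k + 1) * (p * p) := by ring
    rw [this]
    subst hm
    zify at h hr ⊢
    have h' : (p : ℤ) ^ (2 * k + 1) = (p + 1) * (2 * m + 1) - 1 := by linear_combination h
    rw [h', hr]; ring

theorem aux_E (p : ℕ) (hodd : Odd p) (k : ℕ) :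
    ∃ E, Odd E ∧ 2 * E = p ^ (2 * k) + 1 ∧
      Nat.Coprime E ((p ^ (2 * k + 1) - 1) * (p ^ (2 * k + 1) + 1)) := by
  obtain ⟨m, hm⟩ := hodd.pow (n := k)
  have hE : 2 * (2 * (m * m + m) + 1) = p ^ (2 * k) + 1 := by
    rw [mul_comm 2 k, pow_mul, hm]; ring
  generalize hEE : 2 * (m * m + m) + 1 = E at hE
  have hEo : Odd E := ⟨_, hEE.symm⟩
  refine ⟨E, hEo, hE, ?_⟩
  have hp1 : 1 ≤ p ^ (2 * k + 1) := Nat.one_le_pow _ _ hodd.pos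
  rw [← Nat.isCoprime_iff_coprime, Int.isCoprime_iff_gcd_eq_one]
  push_cast [hp1]
  have hEz : 2 * (E : ℤ) = (p : ℤ) ^ (2 * k) + 1 := by exact_mod_cast hE
  set N : ℤ := ((p : ℤ) ^ (2 * k + 1) - 1) * ((p : ℤ) ^ (2 * k + 1) + 1) with hN
  have g1 : (Int.gcd E N : ℤ) ∣ E := Int.gcd_dvd_left ..
  have g2 : (Int.gcd E N : ℤ) ∣ N := Int.gcd_dvd_right ..
  have g3 : (Int.gcd E N : ℤ) ∣ (p : ℤ) ^ 2 - 1 := by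
    have : (p : ℤ) ^ 2 - 1 = N - E * (p ^ 2 * (2 * ((p : ℤ) ^ (2 * k) - 1))) := by
      rw [hN, pow_succ]
      linear_combination (p : ℤ) ^ 2 * ((p : ℤ) ^ (2 * k) - 1) * hEz
    rw [this]
    exact dvd_sub g2 (g1.mul_right _)
  have g4 : (Int.gcd E N : ℤ) ∣ 2 := by
    have h4 : (p : ℤ) ^ 2 - 1 ∣ (p : ℤ) ^ (2 * k) - 1 := by
      rw [pow_mul]; exact sub_one_dvd_pow_sub_one _ _
    have : (2 : ℤ) = 2 * E - ((p : ℤ) ^ (2 * k) - 1) := by rw [hEz]; ring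
    rw [this]
    exact dvd_sub (g1.mul_left _) (g3.trans h4)
  have g5 : Int.gcd E N ∣ 2 := by exact_mod_cast g4
  rcases (Nat.dvd_prime Nat.prime_two).1 g5 with h | h
  · exact h
  · rw [h] at g1
    have : 2 ∣ E := by exact_mod_cast g1
    obtain ⟨a, ha⟩ := hEo
    omega

theorem stmt6 {F : Type*} [Field F] [Fintype F] [DecidableEq F]
    (p n : ℕ) (hp : p.Prime) (hodd : Odd p) (hn : Odd n) (hn' : 0 < n)
    (hcard : Fintype.card F = p ^ n) :
    Function.Bijective
      (fun x : F => (x + 1) ^ ((p ^ n + 1) / (p + 1)) + x ^ ((p ^ n + 1) / (p + 1))) ∧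
    cUnif (fun x : F => x ^ ((p ^ n + 1) / (p + 1))) (-1 : F) = 1 := by
  obtain ⟨k, rfl⟩ := hn
  obtain ⟨d, hd, hdq⟩ := aux_d p hodd k
  obtain ⟨E, hEo, hE, hc⟩ := aux_E p hodd k
  rw [hdq, Nat.mul_div_cancel_left _ (Nat.succ_pos p)]
  have : Fact p.Prime := ⟨hp⟩
  have : CharP F p := charP_of_card_eq_prime_pow hcard
  have h2 : (2 : F) ≠ 0 := by
    apply Ring.two_ne_zero
    rw [ringChar.eq F p]
    rintro rfl
    exact absurd hodd (by decide)
  -- inverse power map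
  have hinv : ∀ x : F, ((x ^ d) ^ E) ^ p = x := by
    intro x
    obtain ⟨m, hm⟩ := hd
    have hp1 : 1 ≤ p ^ (2 * k + 1) := Nat.one_le_pow _ _ hodd.pos
    have e : d * E * p = (p ^ (2 * k + 1) - 1) * (m + 1) + 1 := by
      zify [hp1] at hdq hE hm ⊢
      have e2 : 2 * ((d : ℤ) * E * p) = 2 * (((p : ℤ) ^ (2 * k + 1) - 1) * (m + 1) + 1) := by
        have : 2 * ((d : ℤ) * E * p) = d * p * (2 * E) := by ring
        rw [this, hE]
        have hm' : (2 : ℤ) * m = d - 1 := by rw [hm]; ring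
        rw [pow_succ] at hdq ⊢
        linear_combination -hdq - ((p:ℤ)^(2*k)*p - 1) * hm'
      linarith
    rw [← pow_mul, ← pow_mul, ← mul_assoc, e, pow_succ, pow_mul, ← hcard]
    by_cases hx : x = 0
    · rw [hx, mul_zero]
    · rw [FiniteField.pow_card_sub_one_eq_one x hx, one_pow, one_mul]
  have hdinj : Function.Injective (fun x : F => x ^ d) := by
    intro x y h
    simp only at h
    rw [← hinv x, h, hinv]
  have hinj : Function.Injective (fun x : F => (x + 1) ^ d + x ^ d) := by
    intro x y h
    simp only at h
    by_cases hb : (x + 1) ^ d + x ^ d = 0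
    · have hz : ∀ z : F, (z + 1) ^ d + z ^ d = 0 → 2 * z = -1 := by
        intro z hz
        have : z + 1 = -z := by
          apply hdinj
          simp only
          rw [hd.neg_pow]
          exact eq_neg_of_add_eq_zero_left hz
        linear_combination this
      have hx := hz x hb
      have hy := hz y (h ▸ hb)
      exact mul_left_cancel₀ h2 (hx.trans hy.symm)
    · generalize hbb : (x + 1) ^ d + x ^ d = b at h hb
      have hz : ∀ z : F, (z + 1) ^ d + z ^ d = b →
          (((z + 1) ^ d / b) ^ E + ((z + 1) ^ d / b - 1) ^ E) ^ p = ((b ^ E) ^ p)⁻¹ := by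
        intro z hz
        have e1 : (z + 1) ^ d / b - 1 = -(z ^ d / b) := by
          field_simp
          linear_combination hz
        rw [e1, hEo.neg_pow, div_pow, div_pow, ← sub_eq_add_neg, ← sub_div, div_pow,
          sub_pow_char, hinv, hinv, add_sub_cancel_left, one_div]
      have hw := (hz x hbb).trans (hz y h.symm).symm
      have hw' := frobenius_inj F p hw
      have := aux_inj' (algebraMap F (AlgebraicClosure F)) p (2 * k) E (p ^ (2 * k + 1)) h2 hE hcard _ rfl hc _ _ hw'
      have h3 : (x + 1) ^ d = (y + 1) ^ d := (div_left_inj' hb).1 this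
      exact add_right_cancel (hdinj h3)
  refine ⟨Finite.injective_iff_bijective.1 hinj, ?_⟩
  have hinja : ∀ a : F, Function.Injective (fun x : F => (x + a) ^ d - (-1) * x ^ d) := by
    intro a x y h
    simp only at h
    by_cases ha : a = 0
    · subst ha
      apply hdinj
      simp only [add_zero] at h ⊢
      apply mul_left_cancel₀ h2
      linear_combination h
    · have : x / a = y / a := by
        apply hinj
        simp only
        have hz : ∀ z : F, (z / a + 1) ^ d + (z / a) ^ d = ((z + a) ^ d - (-1) * z ^ d) / a ^ d := by
          intro z
          have : z / a + 1 = (z + a) / a := by field_simp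
          rw [this, div_pow, div_pow]; ring
        rw [hz, hz, h]
      exact (div_left_inj' ha).1 this
  have hone : ∀ a b : F, cDelta (fun x : F => x ^ d) (-1) a b = 1 := by
    intro a b
    obtain ⟨x, hx, hu⟩ := (Finite.injective_iff_bijective.1 (hinja a)).existsUnique b
    unfold cDelta
    rw [Finset.card_eq_one]
    refine ⟨x, ?_⟩
    ext y
    simp only [Finset.mem_filter, Finset.mem_univ, true_and, Finset.mem_singleton]
    exact ⟨fun h => hu y h, fun h => h ▸ hx⟩
  unfold cUnif
  simp only [hone]
  rw [Finset.sup_const Finset.univ_nonempty, Finset.sup_const Finset.univ_nonempty]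
end
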